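/- Let Y be a real random variable on a probability space (Ω,𝓕,ℙ), measurable with respect to a sub-σ-algebra 𝒢 ⊆ 𝓕, with E[Y⁴] < ∞ and σ² := Var(Y) > 0, and let (Y_t)_{t>0} be random variables on the same probability space such that Y_t has the same distribution as Y for every t > 0. Suppose there exist a constant λ > 0, an integrable random variable S, and a real number ρ ≥ 0 such that, as t ↓ 0: (a) (1/t)·E[Y_t − Y | 𝒢] → −λY in L¹(ℙ); (b) (1/t)·E[(Y_t − Y)² | 𝒢] → (2λ + S)·σ² in L¹(ℙ); (c) (1/t)·E[(Y_t − Y)⁴] → ρ·σ⁴. Then, with N a centred Gaussian random variable of variance σ², d_W(Y, N) ≤ (σ/(λ√(2π)))·E[|S|] + (√((2λ + E[S])·σ²)/(3λ))·√ρ. -/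

import Mathlib

open MeasureTheory ProbabilityTheory Filter Real

section StandardGaussian

open Set Topology

local notation "φ" => gaussianPDFReal 0 1

theorem gaussianPDFReal_zero_one_eq (x : ℝ) : φ x = (√(2 * π))⁻¹ * exp (-(1 / 2) * x ^ 2) := by
  simp only [gaussianPDFReal, NNReal.coe_one, mul_one, sub_zero]
  congr 2
  ring

theorem gaussianPDFReal_zero_one_pos (x : ℝ) : 0 < φ x :=
  gaussianPDFReal_pos 0 1 x one_ne_zero

theorem gaussianPDFReal_zero_one_neg (x : ℝ) : φ (-x) = φ x := by
  simp [gaussianPDFReal_zero_one_eq]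

theorem gaussianPDFReal_zero_one_le (x : ℝ) : φ x ≤ φ 0 := by
  rw [gaussianPDFReal_zero_one_eq, gaussianPDFReal_zero_one_eq]
  refine mul_le_mul_of_nonneg_left (exp_le_exp.2 ?_) (by positivity)
  nlinarith [sq_nonneg x]

theorem sq_gaussianPDFReal_zero_one_zero : φ 0 ^ 2 * (2 * π) = 1 := by
  have h : (0 : ℝ) < 2 * π := by positivity
  rw [gaussianPDFReal_zero_one_eq]
  simp only [ne_eq, OfNat.ofNat_ne_zero, not_false_eq_true, zero_pow, mul_zero, exp_zero, mul_one,
    inv_pow, sq_sqrt h.le]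
  field_simp

theorem hasDerivAt_gaussianPDFReal_zero_one (x : ℝ) : HasDerivAt φ (-(x * φ x)) x := by
  have h : HasDerivAt (fun x : ℝ => (√(2 * π))⁻¹ * exp (-(1 / 2) * x ^ 2))
      ((√(2 * π))⁻¹ * (exp (-(1 / 2) * x ^ 2) * (-(1 / 2) * (2 * x)))) x := by
    simpa using (((hasDerivAt_pow 2 x).const_mul (-(1 / 2) : ℝ)).exp).const_mul (√(2 * π))⁻¹
  rw [funext gaussianPDFReal_zero_one_eq]
  convert h using 1
  ring

theorem continuous_gaussianPDFReal_zero_one : Continuous φ :=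
  continuous_iff_continuousAt.2 fun x => (hasDerivAt_gaussianPDFReal_zero_one x).continuousAt

theorem integrable_id_mul_gaussianPDFReal_zero_one : Integrable fun t : ℝ => t * φ t := by
  refine ((integrable_mul_exp_neg_mul_sq (b := 1 / 2) (by norm_num)).const_mul
    (√(2 * π))⁻¹).congr (ae_of_all _ fun t => ?_)
  simp only [gaussianPDFReal_zero_one_eq]
  ring

theorem integrable_sq_mul_gaussianPDFReal_zero_one : Integrable fun t : ℝ => t ^ 2 * φ t := by
  refine ((integrable_rpow_mul_exp_neg_mul_sq (b := 1 / 2) (by norm_num) (s := 2)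
    (by norm_num)).const_mul (√(2 * π))⁻¹).congr (ae_of_all _ fun t => ?_)
  simp only [gaussianPDFReal_zero_one_eq, rpow_ofNat]
  ring

theorem tendsto_gaussianPDFReal_zero_one_cocompact : Tendsto φ (cocompact ℝ) (𝓝 0) := by
  have h := (tendsto_rpow_abs_mul_exp_neg_mul_sq_cocompact (a := 1 / 2) (by norm_num) 0).const_mul
    (√(2 * π))⁻¹
  rw [mul_zero] at h
  refine h.congr fun t => ?_
  simp [gaussianPDFReal_zero_one_eq]

theorem tendsto_id_mul_gaussianPDFReal_zero_one_cocompact :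
    Tendsto (fun t => t * φ t) (cocompact ℝ) (𝓝 0) := by
  have h := (tendsto_rpow_abs_mul_exp_neg_mul_sq_cocompact (a := 1 / 2) (by norm_num) 1).const_mul
    (√(2 * π))⁻¹
  rw [mul_zero] at h
  refine squeeze_zero_norm (fun t => le_of_eq ?_) h
  rw [norm_mul, norm_eq_abs, norm_of_nonneg (gaussianPDFReal_zero_one_pos t).le,
    gaussianPDFReal_zero_one_eq, rpow_one]
  ring

/-- The distribution function of the standard Gaussian law. -/
noncomputable def gaussianLowerTail (x : ℝ) : ℝ := ∫ t in Iic x, φ t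

/-- The complementary distribution function of the standard Gaussian law. -/
noncomputable def gaussianUpperTail (x : ℝ) : ℝ := ∫ t in Ioi x, φ t

local notation "Φ" => gaussianLowerTail
local notation "Ψ" => gaussianUpperTail

theorem gaussianLowerTail_nonneg (x : ℝ) : 0 ≤ Φ x :=
  setIntegral_nonneg measurableSet_Iic fun t _ => (gaussianPDFReal_zero_one_pos t).le

theorem gaussianUpperTail_nonneg (x : ℝ) : 0 ≤ Ψ x :=
  setIntegral_nonneg measurableSet_Ioi fun t _ => (gaussianPDFReal_zero_one_pos t).le

theorem setIntegral_Iic_add_setIntegral_Ioi {g : ℝ → ℝ} (hg : Integrable g) (x : ℝ) :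
    (∫ t in Iic x, g t) + ∫ t in Ioi x, g t = ∫ t, g t := by
  rw [← compl_Iic]
  exact integral_add_compl measurableSet_Iic hg

theorem gaussianLowerTail_add_gaussianUpperTail (x : ℝ) : Φ x + Ψ x = 1 := by
  rw [← integral_gaussianPDFReal_eq_one 0 (one_ne_zero (α := NNReal))]
  exact setIntegral_Iic_add_setIntegral_Ioi (integrable_gaussianPDFReal 0 1) x

theorem gaussianLowerTail_neg (x : ℝ) : Φ (-x) = Ψ x := by
  have h := integral_comp_neg_Iic (-x) φ
  rw [neg_neg] at h
  rw [gaussianUpperTail, ← h, gaussianLowerTail]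
  simp only [gaussianPDFReal_zero_one_neg]

theorem hasDerivAt_setIntegral_Iic {g : ℝ → ℝ} (hg : Integrable g) (hc : Continuous g) (x : ℝ) :
    HasDerivAt (fun y => ∫ t in Iic y, g t) (g x) x := by
  have h : HasDerivAt (fun y => (∫ t in Iic 0, g t) + ∫ t in (0 : ℝ)..y, g t) (g x) x :=
    (intervalIntegral.integral_hasDerivAt_right (hc.intervalIntegrable _ _)
      (hc.stronglyMeasurableAtFilter _ _) hc.continuousAt).const_add _
  convert h using 1
  ext y
  rw [← intervalIntegral.integral_Iic_sub_Iic hg.integrableOn hg.integrableOn]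
  ring

theorem hasDerivAt_gaussianLowerTail (x : ℝ) : HasDerivAt Φ (φ x) x :=
  hasDerivAt_setIntegral_Iic (integrable_gaussianPDFReal 0 1)
    continuous_gaussianPDFReal_zero_one x

theorem setIntegral_Ioi_id_mul_gaussianPDFReal (x : ℝ) : ∫ t in Ioi x, t * φ t = φ x := by
  have h := integral_Ioi_of_hasDerivAt_of_tendsto' (a := x) (f := fun t => -φ t)
    (f' := fun t => t * φ t) (m := 0)
    (fun t _ => by simpa using (hasDerivAt_gaussianPDFReal_zero_one t).fun_neg)
    integrable_id_mul_gaussianPDFReal_zero_one.integrableOn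
    (by simpa using (tendsto_gaussianPDFReal_zero_one_cocompact.mono_left
      atTop_le_cocompact).neg)
  simpa using h

theorem setIntegral_Iic_id_mul_gaussianPDFReal (x : ℝ) : ∫ t in Iic x, t * φ t = -φ x := by
  have h := integral_Iic_of_hasDerivAt_of_tendsto' (a := x) (f := fun t => -φ t)
    (f' := fun t => t * φ t) (m := 0)
    (fun t _ => by simpa using (hasDerivAt_gaussianPDFReal_zero_one t).fun_neg)
    integrable_id_mul_gaussianPDFReal_zero_one.integrableOn
    (by simpa using (tendsto_gaussianPDFReal_zero_one_cocompact.mono_left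
      atBot_le_cocompact).neg)
  simpa using h

theorem setIntegral_Ioi_sub_mul_gaussianPDFReal (x : ℝ) :
    ∫ t in Ioi x, (t - x) * φ t = φ x - x * Ψ x := by
  simp only [sub_mul]
  rw [integral_sub integrable_id_mul_gaussianPDFReal_zero_one.integrableOn
    ((integrable_gaussianPDFReal 0 1).const_mul x).integrableOn,
    setIntegral_Ioi_id_mul_gaussianPDFReal, integral_const_mul, gaussianUpperTail]

theorem setIntegral_Iic_sub_mul_gaussianPDFReal (x : ℝ) :
    ∫ t in Iic x, (x - t) * φ t = φ x + x * Φ x := by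
  simp only [sub_mul]
  rw [integral_sub ((integrable_gaussianPDFReal 0 1).const_mul x).integrableOn
    integrable_id_mul_gaussianPDFReal_zero_one.integrableOn,
    setIntegral_Iic_id_mul_gaussianPDFReal, integral_const_mul, gaussianLowerTail]
  ring

theorem id_mul_gaussianUpperTail_le (x : ℝ) : 0 ≤ φ x - x * Ψ x := by
  rw [← setIntegral_Ioi_sub_mul_gaussianPDFReal]
  exact setIntegral_nonneg measurableSet_Ioi fun t ht =>
    mul_nonneg (sub_nonneg.2 (le_of_lt ht)) (gaussianPDFReal_zero_one_pos t).le

theorem gaussianPDFReal_add_id_mul_gaussianLowerTail_nonneg (x : ℝ) : 0 ≤ φ x + x * Φ x := by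
  rw [← setIntegral_Iic_sub_mul_gaussianPDFReal]
  exact setIntegral_nonneg measurableSet_Iic fun t ht =>
    mul_nonneg (sub_nonneg.2 ht) (gaussianPDFReal_zero_one_pos t).le

/-- The lower bound on the Mills ratio of the standard Gaussian law. -/
theorem id_mul_gaussianPDFReal_le (x : ℝ) : 0 ≤ (1 + x ^ 2) * Ψ x - x * φ x := by
  have i0 := integrable_gaussianPDFReal 0 1
  have i1 := integrable_id_mul_gaussianPDFReal_zero_one
  have i2 := integrable_sq_mul_gaussianPDFReal_zero_one
  have i3 : Integrable fun t : ℝ => t ^ 2 * φ t - φ t := i2.sub i0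
  have h2 : ∫ t in Ioi x, (t ^ 2 * φ t - φ t) = x * φ x := by
    have h := integral_Ioi_of_hasDerivAt_of_tendsto' (a := x) (f := fun t => -(t * φ t))
      (f' := fun t => t ^ 2 * φ t - φ t) (m := 0)
      (fun t _ => by
        convert ((hasDerivAt_id' t).fun_mul (hasDerivAt_gaussianPDFReal_zero_one t)).fun_neg using 1
        ring)
      i3.integrableOn
      (by simpa using (tendsto_id_mul_gaussianPDFReal_zero_one_cocompact.mono_left
        atTop_le_cocompact).neg)
    simpa using h
  have h : ∫ t in Ioi x, (t - x) ^ 2 * φ t = (1 + x ^ 2) * Ψ x - x * φ x := by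
    have e : ∀ t, (t - x) ^ 2 * φ t
        = (t ^ 2 * φ t - φ t) - (2 * x) * (t * φ t) + (1 + x ^ 2) * φ t := fun t => by ring
    have i4 : Integrable fun t : ℝ => (t ^ 2 * φ t - φ t) - (2 * x) * (t * φ t) :=
      i3.sub (i1.const_mul _)
    simp only [e]
    rw [integral_add i4.integrableOn (i0.const_mul _).integrableOn,
      integral_sub i3.integrableOn (i1.const_mul _).integrableOn, h2, integral_const_mul,
      integral_const_mul, setIntegral_Ioi_id_mul_gaussianPDFReal, gaussianUpperTail]
    ring
  rw [← h]
  exact setIntegral_nonneg measurableSet_Ioi fun t _ =>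
    mul_nonneg (sq_nonneg _) (gaussianPDFReal_zero_one_pos t).le

theorem neg_id_mul_gaussianPDFReal_le (x : ℝ) : 0 ≤ (1 + x ^ 2) * Φ x + x * φ x := by
  have h := id_mul_gaussianPDFReal_le (-x)
  rw [← gaussianLowerTail_neg, neg_neg, gaussianPDFReal_zero_one_neg] at h
  linarith

theorem concaveOn_exp_quadratic :
    ConcaveOn ℝ (Ici 0) fun y : ℝ => 4 * exp (-y / 2) + 2 * π * y - (2 + y) ^ 2 := by
  refine concaveOn_of_hasDerivWithinAt2_nonpos (convex_Ici 0) (by fun_prop)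
    (f' := fun y => -2 * exp (-y / 2) + 2 * π - 2 * (2 + y))
    (f'' := fun y => exp (-y / 2) - 2) (fun y _ => ?_) (fun y _ => ?_) (fun y hy => ?_)
  · have h1 : HasDerivAt (fun y : ℝ => exp (-y / 2)) (exp (-y / 2) * (-1 / 2)) y :=
      ((hasDerivAt_neg y).div_const 2).exp
    have h2 : HasDerivAt (fun y : ℝ => (2 + y) ^ 2) (2 * (2 + y)) y := by
      simpa using ((hasDerivAt_id y).const_add 2).fun_pow 2
    have h3 : HasDerivAt (fun y : ℝ => 2 * π * y) (2 * π) y := by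
      simpa using (hasDerivAt_id y).const_mul (2 * π)
    exact (((h1.const_mul 4).fun_add h3).fun_sub h2).congr_deriv (by ring) |>.hasDerivWithinAt
  · have h1 : HasDerivAt (fun y : ℝ => exp (-y / 2)) (exp (-y / 2) * (-1 / 2)) y :=
      ((hasDerivAt_neg y).div_const 2).exp
    have h2 : HasDerivAt (fun y : ℝ => 2 * (2 + y)) 2 y := by
      simpa using ((hasDerivAt_id y).const_add 2).const_mul 2
    exact (((h1.const_mul (-2)).add_const (2 * π)).fun_sub h2).congr_deriv (by ring)
      |>.hasDerivWithinAt
  · rw [interior_Ici] at hy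
    have hy : (0 : ℝ) < y := hy
    have : exp (-y / 2) ≤ 1 := exp_le_one_iff.2 (by linarith)
    linarith

theorem mul_exp_quadratic_le {y z : ℝ} (hy : 0 ≤ y) (hyz : y ≤ z) (hz : 0 < z) :
    y * (4 * exp (-z / 2) + 2 * π * z - (2 + z) ^ 2)
      ≤ z * (4 * exp (-y / 2) + 2 * π * y - (2 + y) ^ 2) := by
  have h := concaveOn_exp_quadratic.2 (mem_Ici.2 hz.le) (mem_Ici.2 le_rfl)
    (div_nonneg hy hz.le) (sub_nonneg.2 ((div_le_one hz).2 hyz)) (by ring)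
  have e : y / z * z = y := by field_simp
  simp only [smul_eq_mul, mul_zero, add_zero, e] at h
  norm_num at h
  rw [div_mul_eq_mul_div, div_le_iff₀ hz] at h
  linarith

/-- A closed-form function squeezed between the centred Gaussian distribution function and `1`. -/
noncomputable def gaussianErrorBound (x : ℝ) : ℝ :=
  2 * (√(φ 0 * φ x + x ^ 2 / 4) - φ x) / x

theorem exists_hasDerivAt_gaussianErrorBound {x : ℝ} (hx : 0 < x) :
    ∃ d : ℝ, HasDerivAt (fun x => gaussianErrorBound x - (2 * Φ x - 1)) d x ∧
      (0 ≤ 4 * exp (-(x ^ 2) / 2) + 2 * π * x ^ 2 - (2 + x ^ 2) ^ 2 → 0 ≤ d) ∧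
      (4 * exp (-(x ^ 2) / 2) + 2 * π * x ^ 2 - (2 + x ^ 2) ^ 2 ≤ 0 → d ≤ 0) := by
  have hφ0 := gaussianPDFReal_zero_one_pos 0
  have hφ := gaussianPDFReal_zero_one_pos x
  set w : ℝ := φ 0 * φ x + x ^ 2 / 4 with hw
  have hwpos : 0 < w := by positivity
  have hs : 0 < √w := sqrt_pos.2 hwpos
  have hss : √w * √w = w := mul_self_sqrt hwpos.le
  have hW : HasDerivAt (fun x => φ 0 * φ x + x ^ 2 / 4) (φ 0 * (-(x * φ x)) + 2 * x / 4) x := by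
    simpa using ((hasDerivAt_gaussianPDFReal_zero_one x).const_mul (φ 0)).fun_add
      ((hasDerivAt_pow 2 x).div_const 4)
  have hD := ((((hW.sqrt hwpos.ne').fun_sub (hasDerivAt_gaussianPDFReal_zero_one x)).const_mul
    2).fun_div (hasDerivAt_id' x) hx.ne').fun_sub (((hasDerivAt_gaussianLowerTail x).const_mul 2).sub_const 1)
  have hexp : exp (-(x ^ 2) / 2) * φ 0 = φ x := by
    rw [gaussianPDFReal_zero_one_eq 0, gaussianPDFReal_zero_one_eq x]
    simp only [ne_eq, OfNat.ofNat_ne_zero, not_false_eq_true, zero_pow, mul_zero, exp_zero,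
      mul_one]
    rw [mul_comm]
    congr 2
    ring
  have hkey : (4 * exp (-(x ^ 2) / 2) + 2 * π * x ^ 2 - (2 + x ^ 2) ^ 2) * φ 0 ^ 2
      = (2 * √w - φ 0 * (2 + x ^ 2)) * (2 * √w + φ 0 * (2 + x ^ 2)) := by
    have h1 : (2 * √w - φ 0 * (2 + x ^ 2)) * (2 * √w + φ 0 * (2 + x ^ 2))
      = 4 * w - φ 0 ^ 2 * (2 + x ^ 2) ^ 2 := by linear_combination 4 * hss
    rw [h1, hw, ← hexp]
    linear_combination x ^ 2 * sq_gaussianPDFReal_zero_one_zero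
  refine ⟨φ x * (2 * √w - φ 0 * (2 + x ^ 2)) / (x ^ 2 * √w), ?_, fun h => ?_, fun h => ?_⟩
  · refine hD.congr_deriv ?_
    rw [← hw]
    field_simp
    linear_combination (-8 : ℝ) * hss - 8 * hw
  · have h1 : 0 ≤ (2 * √w - φ 0 * (2 + x ^ 2)) * (2 * √w + φ 0 * (2 + x ^ 2)) := by
      rw [← hkey]; positivity
    have h2 := nonneg_of_mul_nonneg_left h1 (by positivity)
    positivity
  · have h1 : (2 * √w - φ 0 * (2 + x ^ 2)) * (2 * √w + φ 0 * (2 + x ^ 2)) ≤ 0 := by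
      rw [← hkey]; exact mul_nonpos_of_nonpos_of_nonneg h (by positivity)
    have h2 := nonpos_of_mul_nonpos_left h1 (by positivity)
    exact div_nonpos_of_nonpos_of_nonneg (mul_nonpos_of_nonneg_of_nonpos hφ.le h2) (by positivity)

theorem two_mul_gaussianLowerTail_sub_one_le {x : ℝ} (hx : 0 < x) :
    2 * Φ x - 1 ≤ gaussianErrorBound x := by
  have hder : ∀ y ∈ Ioi (0 : ℝ), HasDerivAt (fun x => gaussianErrorBound x - (2 * Φ x - 1))
      (deriv (fun x => gaussianErrorBound x - (2 * Φ x - 1)) y) y := fun y hy => by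
    obtain ⟨d, hd, -⟩ := exists_hasDerivAt_gaussianErrorBound hy
    exact hd.differentiableAt.hasDerivAt
  set V : ℝ → ℝ := fun x => gaussianErrorBound x - (2 * Φ x - 1) with hV
  suffices 0 ≤ V x by simp only [hV] at this; linarith
  have hcont : ContinuousOn V (Ioi 0) := fun y hy => (hder y hy).continuousAt.continuousWithinAt
  rcases le_total 0 (4 * exp (-(x ^ 2) / 2) + 2 * π * x ^ 2 - (2 + x ^ 2) ^ 2) with hc | hc
  · have hmono : MonotoneOn V (Ioc 0 x) := by
      refine monotoneOn_of_deriv_nonneg (convex_Ioc 0 x) (hcont.mono fun y hy => hy.1)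
        (fun y hy => ?_) (fun y hy => ?_) <;> rw [interior_Ioc] at hy
      · exact (hder y hy.1).differentiableAt.differentiableWithinAt
      · obtain ⟨d, hd, h1, -⟩ := exists_hasDerivAt_gaussianErrorBound (x := y) hy.1
        rw [hd.deriv]
        have h2 := mul_exp_quadratic_le (sq_nonneg y)
          (pow_le_pow_left₀ hy.1.le hy.2.le 2) (pow_pos hx 2)
        exact h1 (nonneg_of_mul_nonneg_right
          ((mul_nonneg (sq_nonneg y) hc).trans h2) (pow_pos hx 2))
    have hΦ0 : 2 * Φ 0 - 1 = 0 := by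
      have h1 := gaussianLowerTail_add_gaussianUpperTail 0
      have h2 := gaussianLowerTail_neg 0
      rw [neg_zero] at h2
      linarith
    have hlim : Tendsto (fun y => -(2 * Φ y - 1)) (𝓝[>] 0) (𝓝 0) := by
      have h1 : Tendsto (fun y => -(2 * Φ y - 1)) (𝓝 0) (𝓝 (-(2 * Φ 0 - 1))) :=
        (((hasDerivAt_gaussianLowerTail 0).continuousAt.tendsto.const_mul 2).sub_const 1).neg
      rw [hΦ0, neg_zero] at h1
      exact h1.mono_left nhdsWithin_le_nhds
    refine le_of_tendsto hlim ?_
    filter_upwards [Ioo_mem_nhdsGT hx] with y hy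
    refine le_trans ?_ (hmono ⟨hy.1, hy.2.le⟩ ⟨hx, le_rfl⟩ hy.2.le)
    have h1 : φ y ≤ √(φ 0 * φ y + y ^ 2 / 4) := by
      refine le_sqrt_of_sq_le ?_
      have := gaussianPDFReal_zero_one_le y
      have := gaussianPDFReal_zero_one_pos y
      nlinarith [sq_nonneg y]
    have h2 : 0 ≤ gaussianErrorBound y :=
      div_nonneg (mul_nonneg zero_le_two (sub_nonneg.2 h1)) hy.1.le
    simp only [hV]
    linarith
  · have hanti : AntitoneOn V (Ici x) := by
      refine antitoneOn_of_deriv_nonpos (convex_Ici x)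
        (hcont.mono fun y hy => lt_of_lt_of_le hx hy)
        (fun y hy => ?_) (fun y hy => ?_) <;> rw [interior_Ici] at hy
      · exact (hder y (hx.trans hy)).differentiableAt.differentiableWithinAt
      · obtain ⟨d, hd, -, h1⟩ := exists_hasDerivAt_gaussianErrorBound (x := y) (hx.trans hy)
        rw [hd.deriv]
        have h2 := mul_exp_quadratic_le (sq_nonneg x)
          (pow_le_pow_left₀ hx.le (le_of_lt hy) 2) (pow_pos (hx.trans hy) 2)
        exact h1 (nonpos_of_mul_nonpos_right
          (h2.trans (mul_nonpos_of_nonneg_of_nonpos (sq_nonneg y) hc)) (pow_pos hx 2))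
    have hlim : Tendsto (fun y => -(2 * φ y)) atTop (𝓝 0) := by
      simpa using ((tendsto_gaussianPDFReal_zero_one_cocompact.mono_left
        atTop_le_cocompact).const_mul 2).neg
    refine le_of_tendsto hlim ?_
    filter_upwards [eventually_ge_atTop x, eventually_ge_atTop 1] with y hxy hy
    refine le_trans ?_ (hanti (mem_Ici.2 le_rfl) hxy hxy)
    have h0 := gaussianPDFReal_zero_one_pos y
    have h1 : y / 2 ≤ √(φ 0 * φ y + y ^ 2 / 4) := by
      refine le_sqrt_of_sq_le ?_
      have := gaussianPDFReal_zero_one_pos 0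
      nlinarith [mul_pos this h0]
    have h2 : 1 - 2 * φ y ≤ gaussianErrorBound y := by
      rw [gaussianErrorBound, le_div_iff₀ (by linarith)]
      nlinarith
    have h3 := gaussianLowerTail_add_gaussianUpperTail y
    have h4 := gaussianUpperTail_nonneg y
    simp only [hV]
    linarith

theorem mul_gaussian_partial_moments_le_of_pos {x : ℝ} (hx : 0 < x) :
    (φ x - x * Ψ x) * (φ x + x * Φ x) ≤ φ 0 * φ x := by
  have h := two_mul_gaussianLowerTail_sub_one_le hx
  have hφ0 := gaussianPDFReal_zero_one_pos 0
  have hφ := gaussianPDFReal_zero_one_pos x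
  have hw : 0 ≤ φ 0 * φ x + x ^ 2 / 4 := by positivity
  have h1 := gaussianLowerTail_add_gaussianUpperTail x
  have h2 := id_mul_gaussianUpperTail_le x
  have h3 := gaussianPDFReal_add_id_mul_gaussianLowerTail_nonneg x
  rw [gaussianErrorBound, le_div_iff₀ hx] at h
  have h4 : Ψ x = 1 - Φ x := by linarith
  rw [h4] at h2 ⊢
  have h5 : φ x + x * (2 * Φ x - 1) / 2 ≤ √(φ 0 * φ x + x ^ 2 / 4) := by linarith
  have h6 := (le_sqrt' (x := φ x + x * (2 * Φ x - 1) / 2) (y := φ 0 * φ x + x ^ 2 / 4)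
    (by nlinarith)).1 h5
  nlinarith

theorem mul_gaussian_partial_moments_le (x : ℝ) :
    (φ x - x * Ψ x) * (φ x + x * Φ x) ≤ φ 0 * φ x := by
  rcases lt_trichotomy x 0 with hx | rfl | hx
  · have h := mul_gaussian_partial_moments_le_of_pos (neg_pos.2 hx)
    have h1 := gaussianLowerTail_neg x
    have h2 := gaussianLowerTail_neg (-x)
    rw [neg_neg] at h2
    rw [h1, ← h2, gaussianPDFReal_zero_one_neg] at h
    linarith
  · simp
  · exact mul_gaussian_partial_moments_le_of_pos hx

theorem integrable_mul_gaussianPDFReal_of_lipschitzWith {h : ℝ → ℝ} (hh : LipschitzWith 1 h) :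
    Integrable fun t => h t * φ t := by
  have i0 := integrable_gaussianPDFReal 0 1
  refine ((i0.const_mul |h 0|).add integrable_id_mul_gaussianPDFReal_zero_one.abs).mono'
    (hh.continuous.mul continuous_gaussianPDFReal_zero_one).aestronglyMeasurable
    (ae_of_all _ fun t => ?_)
  have h1 := hh.dist_le_mul t 0
  simp only [NNReal.coe_one, one_mul, dist_eq, sub_zero] at h1
  have h2 := gaussianPDFReal_zero_one_pos t
  have h3 : |h t| ≤ |h 0| + |t| := by
    have := abs_sub_abs_le_abs_sub (h t) (h 0)
    linarith
  simp only [norm_mul, norm_eq_abs, Pi.add_apply, abs_mul, abs_of_pos h2]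
  nlinarith

/-- The weighted oscillation of a Lipschitz function above a point. -/
theorem abs_setIntegral_Ioi_sub_mul_gaussianPDFReal_le {h : ℝ → ℝ} (hh : LipschitzWith 1 h)
    (x : ℝ) : |∫ t in Ioi x, (h t - h x) * φ t| ≤ φ x - x * Ψ x := by
  rw [← setIntegral_Ioi_sub_mul_gaussianPDFReal, ← norm_eq_abs]
  have i : Integrable fun t : ℝ => (t - x) * φ t := by
    simp only [sub_mul]
    exact integrable_id_mul_gaussianPDFReal_zero_one.sub
      ((integrable_gaussianPDFReal 0 1).const_mul x)
  refine norm_integral_le_of_norm_le i.integrableOn ?_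
  filter_upwards [ae_restrict_mem measurableSet_Ioi] with t ht
  have h1 := hh.dist_le_mul t x
  rw [NNReal.coe_one, one_mul, dist_eq, dist_eq, abs_of_pos (sub_pos.2 (mem_Ioi.1 ht))] at h1
  rw [norm_mul, norm_eq_abs, norm_of_nonneg (gaussianPDFReal_zero_one_pos t).le]
  exact mul_le_mul_of_nonneg_right h1 (gaussianPDFReal_zero_one_pos t).le

/-- The weighted oscillation of a Lipschitz function below a point. -/
theorem abs_setIntegral_Iic_sub_mul_gaussianPDFReal_le {h : ℝ → ℝ} (hh : LipschitzWith 1 h)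
    (x : ℝ) : |∫ t in Iic x, (h x - h t) * φ t| ≤ φ x + x * Φ x := by
  rw [← setIntegral_Iic_sub_mul_gaussianPDFReal, ← norm_eq_abs]
  have i : Integrable fun t : ℝ => (x - t) * φ t := by
    simp only [sub_mul]
    exact ((integrable_gaussianPDFReal 0 1).const_mul x).sub
      integrable_id_mul_gaussianPDFReal_zero_one
  refine norm_integral_le_of_norm_le i.integrableOn ?_
  filter_upwards [ae_restrict_mem measurableSet_Iic] with t ht
  have h1 := hh.dist_le_mul x t
  rw [NNReal.coe_one, one_mul, dist_eq, dist_eq, abs_of_nonneg (sub_nonneg.2 (mem_Iic.1 ht))] at h1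
  rw [norm_mul, norm_eq_abs, norm_of_nonneg (gaussianPDFReal_zero_one_pos t).le]
  exact mul_le_mul_of_nonneg_right h1 (gaussianPDFReal_zero_one_pos t).le

/-- The Stein equation for the standard Gaussian law with a `1`-Lipschitz right-hand side has a
solution satisfying the sharp uniform bounds. -/
theorem exists_stein_solution_standard {h : ℝ → ℝ} (hh : LipschitzWith 1 h) :
    ∃ f f' : ℝ → ℝ, (∀ x, HasDerivAt f (f' x) x) ∧
      (∀ x, f' x - x * f x = h x - ∫ t, h t ∂(gaussianReal 0 1)) ∧
      (∀ x, |f x| ≤ 1) ∧ (∀ x, |f' x| ≤ √(2 / π)) ∧ LipschitzWith 2 f' := by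
  set c : ℝ := ∫ t, h t ∂(gaussianReal 0 1) with hc
  have hcφ : c = ∫ t, h t * φ t := by
    rw [hc, integral_gaussianReal_eq_integral_smul one_ne_zero]
    simp only [smul_eq_mul, mul_comm]
  have i0 := integrable_gaussianPDFReal 0 1
  have ih := integrable_mul_gaussianPDFReal_of_lipschitzWith hh
  have ihc : Integrable fun t => (h t - c) * φ t := by
    simp only [sub_mul]
    exact ih.sub (i0.const_mul c)
  set A : ℝ → ℝ := fun x => ∫ t in Ioi x, (h t - h x) * φ t with hA
  set B : ℝ → ℝ := fun x => ∫ t in Iic x, (h x - h t) * φ t with hB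
  set J : ℝ → ℝ := fun x => ∫ t in Iic x, (h t - c) * φ t with hJ
  have hA' : ∀ x, A x = (∫ t in Ioi x, h t * φ t) - h x * Ψ x := fun x => by
    simp only [hA, sub_mul]
    rw [integral_sub ih.integrableOn (i0.const_mul _).integrableOn, integral_const_mul,
      gaussianUpperTail]
  have hB' : ∀ x, B x = h x * Φ x - ∫ t in Iic x, h t * φ t := fun x => by
    simp only [hB, sub_mul]
    rw [integral_sub (i0.const_mul _).integrableOn ih.integrableOn, integral_const_mul,
      gaussianLowerTail]
  have hJ' : ∀ x, J x = (∫ t in Iic x, h t * φ t) - c * Φ x := fun x => by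
    simp only [hJ, sub_mul]
    rw [integral_sub ih.integrableOn (i0.const_mul _).integrableOn, integral_const_mul,
      gaussianLowerTail]
  have hAB : ∀ x, h x - c = B x - A x := fun x => by
    have h1 := setIntegral_Iic_add_setIntegral_Ioi ih x
    have h2 := gaussianLowerTail_add_gaussianUpperTail x
    rw [← hcφ] at h1
    rw [hA', hB']
    linear_combination h1 - h x * h2
  have hJAB : ∀ x, J x = -(A x * Φ x + B x * Ψ x) := fun x => by
    have h2 := gaussianLowerTail_add_gaussianUpperTail x
    have h3 := hAB x
    linear_combination hJ' x + hB' x + Φ x * h3 + B x * h2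
  have hAle : ∀ x, |A x| ≤ φ x - x * Ψ x :=
    abs_setIntegral_Ioi_sub_mul_gaussianPDFReal_le hh
  have hBle : ∀ x, |B x| ≤ φ x + x * Φ x :=
    abs_setIntegral_Iic_sub_mul_gaussianPDFReal_le hh
  have hφ := gaussianPDFReal_zero_one_pos
  have hcomb : ∀ x a b : ℝ, 0 ≤ a → 0 ≤ b →
      |A x * a + B x * b| ≤ (φ x - x * Ψ x) * a + (φ x + x * Φ x) * b := fun x a b ha hb => by
    refine (abs_add_le _ _).trans ?_
    rw [abs_mul, abs_mul, abs_of_nonneg ha, abs_of_nonneg hb]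
    exact add_le_add (mul_le_mul_of_nonneg_right (hAle x) ha)
      (mul_le_mul_of_nonneg_right (hBle x) hb)
  set f : ℝ → ℝ := fun x => J x / φ x with hf
  set f' : ℝ → ℝ := fun x => x * f x + (h x - c) with hf'
  have hfφ : ∀ x, f x * φ x = -(A x * Φ x + B x * Ψ x) := fun x => by
    rw [← hJAB, hf, div_mul_cancel₀ _ (hφ x).ne']
  have hder : ∀ x, HasDerivAt f (f' x) x := fun x => by
    have hJd : HasDerivAt J ((h x - c) * φ x) x :=
      hasDerivAt_setIntegral_Iic ihc
        ((hh.continuous.sub continuous_const).mul continuous_gaussianPDFReal_zero_one) x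
    refine (hJd.fun_div (hasDerivAt_gaussianPDFReal_zero_one x) (hφ x).ne').congr_deriv ?_
    have := (hφ x).ne'
    simp only [hf', hf]
    field_simp
    ring
  have habs : ∀ {x y z : ℝ}, y * φ x = -z → |z| ≤ φ x → |y| ≤ 1 := fun {x y z} h1 h2 => by
    rw [← abs_neg, ← h1, abs_mul, abs_of_pos (hφ x)] at h2
    exact le_of_mul_le_mul_right (by linarith) (hφ x)
  have hxf : ∀ x, |f x + x * f' x| ≤ 1 := fun x => by
    refine habs (x := x) (z := A x * ((1 + x ^ 2) * Φ x + x * φ x)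
      + B x * ((1 + x ^ 2) * Ψ x - x * φ x)) ?_
      ((hcomb x _ _ (neg_id_mul_gaussianPDFReal_le x) (id_mul_gaussianPDFReal_le x)).trans_eq ?_)
    · simp only [hf']
      linear_combination (1 + x ^ 2) * hfφ x + x * φ x * hAB x
    · linear_combination (φ x) * gaussianLowerTail_add_gaussianUpperTail x
  refine ⟨f, f', hder, fun x => by simp [hf'], fun x => ?_, fun x => ?_, ?_⟩
  · refine habs (hfφ x) ((hcomb x _ _ (gaussianLowerTail_nonneg x)
      (gaussianUpperTail_nonneg x)).trans_eq ?_)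
    linear_combination (φ x) * gaussianLowerTail_add_gaussianUpperTail x
  · have h1 : f' x * φ x = -(A x * (φ x + x * Φ x) + (-B x) * (φ x - x * Ψ x)) := by
      simp only [hf']
      linear_combination x * hfφ x + φ x * hAB x
    have h2 : |f' x| * φ x ≤ 2 * (φ 0 * φ x) := by
      have hA0 := id_mul_gaussianUpperTail_le x
      have hB0 := gaussianPDFReal_add_id_mul_gaussianLowerTail_nonneg x
      have h3 := mul_gaussian_partial_moments_le x
      rw [← abs_of_pos (hφ x), ← abs_mul, h1, abs_neg, abs_of_pos (hφ x)]
      refine (abs_add_le _ _).trans ?_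
      rw [abs_mul, abs_mul, abs_neg, abs_of_nonneg hA0, abs_of_nonneg hB0]
      nlinarith [mul_le_mul_of_nonneg_right (hAle x) hB0,
        mul_le_mul_of_nonneg_right (hBle x) hA0]
    have h4 : |f' x| ≤ 2 * φ 0 := le_of_mul_le_mul_right (by linarith) (hφ x)
    refine h4.trans (le_sqrt_of_sq_le (le_of_eq ?_))
    rw [eq_div_iff pi_pos.ne']
    linear_combination 2 * sq_gaussianPDFReal_zero_one_zero
  · have hxfd : ∀ x, HasDerivAt (fun x => x * f x) (f x + x * f' x) x := fun x =>
      ((hasDerivAt_id' x).fun_mul (hder x)).congr_deriv (by ring)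
    have hl : LipschitzWith 1 fun x => x * f x :=
      lipschitzWith_of_nnnorm_deriv_le (fun x => (hxfd x).differentiableAt) fun x => by
        rw [(hxfd x).deriv, ← NNReal.coe_le_coe]
        simpa using hxf x
    have h3 := hl.add (hh.sub (LipschitzWith.const c))
    rw [add_zero, one_add_one_eq_two] at h3
    exact h3

end StandardGaussian

/-- The Stein equation for a centred Gaussian law with a `1`-Lipschitz right-hand side has a
solution satisfying the sharp uniform bounds. -/
theorem exists_stein_solution {h : ℝ → ℝ} (hh : LipschitzWith 1 h) {v : ℝ} (hv : 0 < v) :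
    ∃ f f' : ℝ → ℝ, (∀ x, HasDerivAt f (f' x) x) ∧
      (∀ x, v * f' x - x * f x = h x - ∫ t, h t ∂(gaussianReal 0 v.toNNReal)) ∧
      (∀ x, |f x| ≤ 1) ∧ (∀ x, |f' x| ≤ √(2 / π) / √v) ∧
      ∀ x y, |f' x - f' y| ≤ 2 / v * |x - y| := by
  set s : ℝ := √v with hs
  have hspos : 0 < s := sqrt_pos.2 hv
  have hsv : s * s = v := mul_self_sqrt hv.le
  have hk : LipschitzWith 1 fun x => h (s * x) / s := by
    refine LipschitzWith.of_dist_le_mul fun x y => ?_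
    have h1 := hh.dist_le_mul (s * x) (s * y)
    rw [NNReal.coe_one, one_mul, dist_eq, dist_eq, ← mul_sub, abs_mul, abs_of_pos hspos] at h1
    rw [NNReal.coe_one, one_mul, dist_eq, dist_eq, ← sub_div, abs_div, abs_of_pos hspos,
      div_le_iff₀ hspos]
    linarith
  obtain ⟨f, f', hder, heq, hf, hf', hlip⟩ := exists_stein_solution_standard hk
  have hgauss : ∫ t, h t ∂(gaussianReal 0 v.toNNReal) = ∫ x, h (s * x) ∂(gaussianReal 0 1) := by
    have h1 := gaussianReal_map_const_mul (μ := 0) (v := 1) s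
    have h2 : NNReal.mk (s ^ 2) (sq_nonneg s) * 1 = v.toNNReal := by
      ext
      simp [pow_two, hsv, hv.le]
    rw [mul_zero, h2] at h1
    rw [← h1, integral_map (by fun_prop) hh.continuous.aestronglyMeasurable]
  refine ⟨fun x => f (x / s), fun x => f' (x / s) / s, fun x => ?_, fun x => ?_,
    fun x => hf _, fun x => ?_, fun x y => ?_⟩
  · have h1 := (hder (x / s)).comp x ((hasDerivAt_id' x).div_const s)
    exact h1.congr_deriv (by ring)
  · have h1 := heq (x / s)
    rw [integral_div, mul_div_cancel₀ _ hspos.ne', ← hgauss] at h1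
    field_simp at h1
    rw [← h1, ← hsv]
    field_simp
  · rw [abs_div, abs_of_pos hspos]
    exact div_le_div_of_nonneg_right (hf' _) hspos.le
  · have h1 := hlip.dist_le_mul (x / s) (y / s)
    rw [dist_eq, dist_eq, ← sub_div, abs_div, abs_of_pos hspos] at h1
    rw [← sub_div, abs_div, abs_of_pos hspos, ← hsv, div_le_iff₀ hspos]
    refine h1.trans_eq ?_
    rw [NNReal.coe_ofNat]
    field_simp

theorem abs_le_of_abs_deriv_le_pow {g g' : ℝ → ℝ} (hg : ∀ t, HasDerivAt g (g' t) t)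
    (h0 : g 0 = 0) {C : ℝ} {n : ℕ} (hC : ∀ t, |g' t| ≤ C * |t| ^ n) (t : ℝ) :
    |g t| ≤ C / (n + 1) * |t| ^ (n + 1) := by
  have key : ∀ {g g' : ℝ → ℝ}, (∀ t, HasDerivAt g (g' t) t) → g 0 = 0 →
      (∀ t, |g' t| ≤ C * |t| ^ n) → ∀ t, 0 ≤ t → |g t| ≤ C / (n + 1) * t ^ (n + 1) := by
    intro g g' hg h0 hC t ht
    refine image_norm_le_of_norm_deriv_right_le_deriv_boundary (a := 0) (b := t)
      (B := fun t => C / (n + 1) * t ^ (n + 1)) (B' := fun t => C * t ^ n)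
      (fun x _ => (hg x).continuousAt.continuousWithinAt)
      (fun x _ => (hg x).hasDerivWithinAt) (by simp [h0]) (fun x => ?_) (fun x hx => ?_)
      ⟨ht, le_rfl⟩
    · refine ((hasDerivAt_pow (n + 1) x).const_mul (C / (n + 1))).congr_deriv ?_
      have : (n + 1 : ℝ) ≠ 0 := by positivity
      push_cast
      field_simp
    · simpa [abs_of_nonneg hx.1] using hC x
  rcases le_total 0 t with ht | ht
  · rw [abs_of_nonneg ht]
    exact key hg h0 hC t ht
  · have h1 := key (g := fun t => g (-t)) (g' := fun t => -g' (-t))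
      (fun t => ((hg (-t)).comp t (hasDerivAt_neg t)).congr_deriv (by ring)) (by simpa using h0)
      (fun t => by simpa using hC (-t)) (-t) (neg_nonneg.2 ht)
    rw [abs_of_nonpos ht]
    simpa using h1

/-- Third-order Taylor remainder for a function whose second derivative is Lipschitz. -/
theorem abs_taylor_remainder_le {F f f' : ℝ → ℝ} (hF : ∀ x, HasDerivAt F (f x) x)
    (hf : ∀ x, HasDerivAt f (f' x) x) {L : ℝ} (hL : ∀ x y, |f' x - f' y| ≤ L * |x - y|)
    (x u : ℝ) :
    |F (x + u) - F x - f x * u - f' x * u ^ 2 / 2| ≤ L / 6 * |u| ^ 3 := by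
  have h1 : ∀ u, |f (x + u) - f x - f' x * u| ≤ L / 2 * |u| ^ 2 := fun u => by
    have h := abs_le_of_abs_deriv_le_pow (g := fun u => f (x + u) - f x - f' x * u)
      (g' := fun u => f' (x + u) - f' x) (C := L) (n := 1)
      (fun t => (((hf (x + t)).comp_const_add x t).sub_const (f x)).fun_sub
        (((hasDerivAt_id' t).const_mul (f' x)).congr_deriv (by ring)))
      (by simp) (fun t => by simpa using hL (x + t) x) u
    norm_num at h ⊢
    exact h
  have h := abs_le_of_abs_deriv_le_pow
    (g := fun u => F (x + u) - F x - f x * u - f' x * u ^ 2 / 2)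
    (g' := fun u => f (x + u) - f x - f' x * u) (C := L / 2) (n := 2)
    (fun t => ((((hF (x + t)).comp_const_add x t).sub_const (F x)).fun_sub
        ((hasDerivAt_id' t).const_mul (f x))).fun_sub
          (((hasDerivAt_pow 2 t).const_mul (f' x)).div_const 2) |>.congr_deriv
            (by push_cast; ring))
    (by simp) h1 u
  refine h.trans_eq ?_
  push_cast
  ring

theorem integral_abs_pow_three_le_sqrt {Ω : Type*} {mΩ : MeasurableSpace Ω} {P : Measure Ω}
    {Z : Ω → ℝ} (hZ : AEStronglyMeasurable Z P) (h2 : Integrable (fun ω => Z ω ^ 2) P)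
    (h4 : Integrable (fun ω => Z ω ^ 4) P) :
    (∫ ω, |Z ω| ^ 3 ∂P) ≤ √((∫ ω, Z ω ^ 2 ∂P) * ∫ ω, Z ω ^ 4 ∂P) := by
  have m1 : MemLp (fun ω => |Z ω|) (ENNReal.ofReal 2) P := by
    rw [ENNReal.ofReal_ofNat]
    exact ((memLp_two_iff_integrable_sq hZ).2 h2).abs
  have m2 : MemLp (fun ω => Z ω ^ 2) (ENNReal.ofReal 2) P := by
    rw [ENNReal.ofReal_ofNat]
    refine (memLp_two_iff_integrable_sq (hZ.pow 2)).2 (h4.congr (ae_of_all _ fun ω => ?_))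
    simp only [Pi.pow_apply]
    ring
  have h := integral_mul_le_Lp_mul_Lq_of_nonneg (p := 2) (q := 2) HolderConjugate.two_two
    (ae_of_all P fun ω => abs_nonneg (Z ω)) (ae_of_all P fun ω => sq_nonneg (Z ω)) m1 m2
  have e : ∀ x : ℝ, |x| * x ^ 2 = |x| ^ 3 := fun x => by rw [← sq_abs]; ring
  have e4 : ∀ x : ℝ, (x ^ 2) ^ 2 = x ^ 4 := fun x => by ring
  simp only [rpow_ofNat, sq_abs, e, e4, ← sqrt_eq_rpow] at h
  rwa [sqrt_mul (integral_nonneg fun ω => sq_nonneg (Z ω))]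

/-- Testing the `L¹` limit of rescaled conditional expectations against bounded observables. -/
theorem tendsto_integral_mul_of_tendsto_condExp {Ω : Type*} {𝒢 mΩ : MeasurableSpace Ω}
    {P : Measure Ω} [IsProbabilityMeasure P] (h𝒢 : 𝒢 ≤ mΩ) {g : Ω → ℝ}
    (hg : StronglyMeasurable[𝒢] g) {C : ℝ} (hC : ∀ ω, |g ω| ≤ C) {Z : ℝ → Ω → ℝ}
    (hZ : ∀ t > 0, Integrable (Z t) P) {L : Ω → ℝ} (hL : Integrable L P)
    (hlim : Tendsto (fun t : ℝ => ∫ ω, |t⁻¹ * (P[Z t | 𝒢]) ω - L ω| ∂P)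
      (nhdsWithin 0 (Set.Ioi 0)) (nhds 0)) :
    Tendsto (fun t : ℝ => t⁻¹ * ∫ ω, g ω * Z t ω ∂P)
      (nhdsWithin 0 (Set.Ioi 0)) (nhds (∫ ω, g ω * L ω ∂P)) := by
  have hgm : AEStronglyMeasurable g P := (hg.mono h𝒢).aestronglyMeasurable
  have hbdd : ∀ᵐ ω ∂P, ‖g ω‖ ≤ C := ae_of_all _ hC
  rw [tendsto_iff_norm_sub_tendsto_zero]
  have hlim' := hlim.const_mul C
  rw [mul_zero] at hlim'
  refine squeeze_zero' (Eventually.of_forall fun t => norm_nonneg _) ?_ hlim'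
  filter_upwards [self_mem_nhdsWithin] with t ht
  have i1 : Integrable (fun ω => g ω * Z t ω) P := (hZ t ht).bdd_mul hgm hbdd
  have i2 : Integrable (fun ω => t⁻¹ * (P[Z t | 𝒢]) ω - L ω) P :=
    (integrable_condExp.const_mul _).sub hL
  have e1 : ∫ ω, g ω * Z t ω ∂P = ∫ ω, g ω * (P[Z t | 𝒢]) ω ∂P := by
    rw [← integral_condExp h𝒢]
    exact integral_congr_ae (condExp_mul_of_stronglyMeasurable_left hg i1 (hZ t ht))
  have e2 : t⁻¹ * ∫ ω, g ω * Z t ω ∂P - ∫ ω, g ω * L ω ∂P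
      = ∫ ω, g ω * (t⁻¹ * (P[Z t | 𝒢]) ω - L ω) ∂P := by
    rw [e1, ← integral_const_mul, ← integral_sub
      ((integrable_condExp.bdd_mul hgm hbdd).const_mul _) (hL.bdd_mul hgm hbdd)]
    exact integral_congr_ae (ae_of_all _ fun ω => by ring)
  rw [e2, ← integral_const_mul]
  refine norm_integral_le_of_norm_le (i2.abs.const_mul C) (ae_of_all _ fun ω => ?_)
  rw [norm_mul, norm_eq_abs, norm_eq_abs]
  exact mul_le_mul_of_nonneg_right (hC ω) (abs_nonneg _)

/-- **Abstract exchangeable-pairs plug-in result, univariate case**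
(Proposition 3.4 in Döbler–Vidotto–Zheng, "Fourth moment theorems on the Poisson space
in any dimension").

Let `Y ∈ L⁴(Ω, 𝒢, P)` with `σ² := Var(Y) > 0` and let `(Y_t)_{t>0}` have the same
distribution as `Y`.  Assume, as `t ↓ 0`,
(a) `(1/t)·E[Y_t − Y | 𝒢] → −λY` in `L¹(P)` for some `λ > 0`;
(b) `(1/t)·E[(Y_t − Y)² | 𝒢] → (2λ + S)·σ²` in `L¹(P)` for some integrable `S`;
(c) `(1/t)·E[(Y_t − Y)⁴] → ρ·σ⁴` for some `ρ ≥ 0`.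
Then, with `N ∼ 𝒩(0, σ²)`,
`d_W(Y, N) ≤ (σ/(λ√(2π)))·E|S| + (√((2λ + E[S])·σ²)/(3λ))·√ρ`,
where the Wasserstein distance is the supremum of `|E[h(Y)] − E[h(N)]|` over all
`1`-Lipschitz functions `h : ℝ → ℝ`. -/
theorem fourth_moment_exchangeable_pairs_univariate
    {Ω : Type*} {𝒢 : MeasurableSpace Ω} {mΩ : MeasurableSpace Ω}
    {P : Measure Ω} [IsProbabilityMeasure P]
    (h𝒢 : 𝒢 ≤ mΩ)
    (Y : Ω → ℝ) (hYmeas : StronglyMeasurable[𝒢] Y)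
    (hY4 : Integrable (fun ω => (Y ω) ^ 4) P)
    (hσ : 0 < variance Y P)
    (Yt : ℝ → Ω → ℝ)
    (hYt_meas : ∀ t > (0 : ℝ), AEMeasurable (Yt t) P)
    (hYt_law : ∀ t > (0 : ℝ), Measure.map (Yt t) P = Measure.map Y P)
    (lam : ℝ) (hlam : 0 < lam)
    (S : Ω → ℝ) (hS : Integrable S P)
    (ρ : ℝ) (hρ : 0 ≤ ρ)
    (ha : Tendsto (fun t : ℝ =>
        ∫ ω, |t⁻¹ * (P[fun ω => Yt t ω - Y ω | 𝒢]) ω - (-(lam * Y ω))| ∂P)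
      (nhdsWithin 0 (Set.Ioi 0)) (nhds 0))
    (hb : Tendsto (fun t : ℝ =>
        ∫ ω, |t⁻¹ * (P[fun ω => (Yt t ω - Y ω) ^ 2 | 𝒢]) ω
              - (2 * lam + S ω) * variance Y P| ∂P)
      (nhdsWithin 0 (Set.Ioi 0)) (nhds 0))
    (hc : Tendsto (fun t : ℝ => t⁻¹ * ∫ ω, (Yt t ω - Y ω) ^ 4 ∂P)
      (nhdsWithin 0 (Set.Ioi 0)) (nhds (ρ * (variance Y P) ^ 2))) :
    ∀ h : ℝ → ℝ, LipschitzWith 1 h →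
      |(∫ ω, h (Y ω) ∂P) - ∫ x, h x ∂(gaussianReal 0 (variance Y P).toNNReal)|
        ≤ Real.sqrt (variance Y P) / (lam * Real.sqrt (2 * π)) * (∫ ω, |S ω| ∂P)
          + Real.sqrt ((2 * lam + ∫ ω, S ω ∂P) * variance Y P) / (3 * lam)
            * Real.sqrt ρ := by
  intro h hh
  set v : ℝ := variance Y P
  obtain ⟨f, f', hder, hstein, hf, hf', hlip⟩ := exists_stein_solution hh hσ
  have hfc : Continuous f := continuous_iff_continuousAt.2 fun x => (hder x).continuousAt
  have hf'lip : LipschitzWith (2 / v).toNNReal f' := LipschitzWith.of_dist_le_mul fun x y => by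
    rw [coe_toNNReal _ (by positivity), dist_eq, dist_eq]
    exact hlip x y
  have hf'c : Continuous f' := hf'lip.continuous
  have hYm : AEStronglyMeasurable Y P := (hYmeas.mono h𝒢).aestronglyMeasurable
  have hYL4 : MemLp Y 4 P := by
    refine (integrable_norm_rpow_iff hYm (by norm_num) (by norm_num)).1
      (hY4.congr (ae_of_all _ fun ω => ?_))
    norm_num [Even.pow_abs (show Even 4 by decide)]
  have hident : ∀ t > 0, IdentDistrib (Yt t) Y P P := fun t ht =>
    ⟨hYt_meas t ht, hYm.aemeasurable, hYt_law t ht⟩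
  have hZL4 : ∀ t > 0, MemLp (fun ω => Yt t ω - Y ω) 4 P := fun t ht =>
    ((hident t ht).memLp_iff.2 hYL4).sub hYL4
  have hYint : Integrable Y P := hYL4.integrable (by norm_num)
  have hZ1 : ∀ t > 0, Integrable (fun ω => Yt t ω - Y ω) P := fun t ht =>
    (hZL4 t ht).integrable (by norm_num)
  have hZpow : ∀ t > 0, ∀ n : ℕ, n ≤ 4 → Integrable (fun ω => |Yt t ω - Y ω| ^ n) P :=
    fun t ht n hn => ((hZL4 t ht).mono_exponent (by exact_mod_cast hn)).integrable_norm_pow'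
  have hZ2 : ∀ t > 0, Integrable (fun ω => (Yt t ω - Y ω) ^ 2) P := fun t ht => by
    simpa only [sq_abs] using hZpow t ht 2 (by norm_num)
  have hZ4 : ∀ t > 0, Integrable (fun ω => (Yt t ω - Y ω) ^ 4) P := fun t ht => by
    simpa only [Even.pow_abs (show Even 4 by decide)] using hZpow t ht 4 le_rfl
  have hSv : Integrable (fun ω => (2 * lam + S ω) * v) P :=
    ((integrable_const _).add hS).mul_const v
  have hlY : Integrable (fun ω => -(lam * Y ω)) P := (hYint.const_mul lam).neg
  have lim1 := tendsto_integral_mul_of_tendsto_condExp h𝒢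
    (hfc.comp_stronglyMeasurable hYmeas) (fun ω => hf (Y ω)) hZ1 hlY ha
  have lim2 := tendsto_integral_mul_of_tendsto_condExp h𝒢
    (hf'c.comp_stronglyMeasurable hYmeas) (fun ω => hf' (Y ω)) hZ2 hSv hb
  have lim3 := tendsto_integral_mul_of_tendsto_condExp h𝒢 (g := fun _ => 1)
    (C := 1) stronglyMeasurable_const (fun _ => by simp) hZ2 hSv hb
  simp only [one_mul] at lim3
  set F : ℝ → ℝ := fun x => ∫ y in (0 : ℝ)..x, f y
  have hF : ∀ x, HasDerivAt F (f x) x := fun x =>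
    intervalIntegral.integral_hasDerivAt_right (hfc.intervalIntegrable _ _)
      (hfc.stronglyMeasurableAtFilter _ _) hfc.continuousAt
  have hFc : Continuous F := continuous_iff_continuousAt.2 fun x => (hF x).continuousAt
  have hFbd : ∀ x, ‖F x‖ ≤ ‖x‖ := fun x => by
    simpa using intervalIntegral.norm_integral_le_of_norm_le_const (f := f) (C := 1)
      (a := 0) (b := x) fun y _ => hf y
  have hFY : Integrable (fun ω => F (Y ω)) P :=
    hYint.mono (hFc.comp_aestronglyMeasurable hYm) (ae_of_all _ fun ω => hFbd _)
  have hbound : ∀ t > 0, |t⁻¹ * (∫ ω, f (Y ω) * (Yt t ω - Y ω) ∂P)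
      + t⁻¹ * (∫ ω, f' (Y ω) * (Yt t ω - Y ω) ^ 2 ∂P) / 2|
      ≤ 2 / v / 6 * √((t⁻¹ * ∫ ω, (Yt t ω - Y ω) ^ 2 ∂P)
        * (t⁻¹ * ∫ ω, (Yt t ω - Y ω) ^ 4 ∂P)) := fun t ht => by
    have hFYt : Integrable (fun ω => F (Yt t ω)) P :=
      ((hident t ht).comp hFc.measurable).integrable_iff.2 hFY
    have e0 : ∫ ω, F (Yt t ω) ∂P = ∫ ω, F (Y ω) ∂P :=
      ((hident t ht).comp hFc.measurable).integral_eq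
    have i1 : Integrable (fun ω => f (Y ω) * (Yt t ω - Y ω)) P :=
      (hZ1 t ht).bdd_mul (hfc.comp_aestronglyMeasurable hYm) (ae_of_all _ fun ω => hf (Y ω))
    have i2 : Integrable (fun ω => f' (Y ω) * (Yt t ω - Y ω) ^ 2) P :=
      (hZ2 t ht).bdd_mul (hf'c.comp_aestronglyMeasurable hYm) (ae_of_all _ fun ω => hf' (Y ω))
    have i3 : Integrable (fun ω => F (Yt t ω) - F (Y ω)) P := hFYt.sub hFY
    have i4 : Integrable (fun ω => F (Yt t ω) - F (Y ω) - f (Y ω) * (Yt t ω - Y ω)) P :=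
      i3.sub i1
    have e1 : ∫ ω, (F (Yt t ω) - F (Y ω) - f (Y ω) * (Yt t ω - Y ω)
          - f' (Y ω) * (Yt t ω - Y ω) ^ 2 / 2) ∂P
        = -((∫ ω, f (Y ω) * (Yt t ω - Y ω) ∂P)
          + (∫ ω, f' (Y ω) * (Yt t ω - Y ω) ^ 2 ∂P) / 2) := by
      rw [integral_sub i4 (i2.div_const 2), integral_sub i3 i1, integral_sub hFYt hFY, e0,
        integral_div]
      ring
    have h1 : |(∫ ω, f (Y ω) * (Yt t ω - Y ω) ∂P)
        + (∫ ω, f' (Y ω) * (Yt t ω - Y ω) ^ 2 ∂P) / 2|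
        ≤ 2 / v / 6 * ∫ ω, |Yt t ω - Y ω| ^ 3 ∂P := by
      rw [← abs_neg, ← e1, ← integral_const_mul, ← norm_eq_abs]
      refine norm_integral_le_of_norm_le ((hZpow t ht 3 (by norm_num)).const_mul _)
        (ae_of_all _ fun ω => ?_)
      simpa using abs_taylor_remainder_le hF hder hlip (Y ω) (Yt t ω - Y ω)
    have h2 := h1.trans (mul_le_mul_of_nonneg_left (integral_abs_pow_three_le_sqrt
      (hZL4 t ht).aestronglyMeasurable (hZ2 t ht) (hZ4 t ht)) (by positivity))
    have ht' : (0 : ℝ) ≤ t⁻¹ := inv_nonneg.2 (le_of_lt ht)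
    rw [mul_mul_mul_comm, sqrt_mul (mul_self_nonneg _), sqrt_mul_self ht', mul_div_assoc,
      ← mul_add, abs_mul, abs_of_nonneg ht', mul_left_comm]
    exact mul_le_mul_of_nonneg_left h2 ht'
  have hlimit := le_of_tendsto_of_tendsto (lim1.add (lim2.div_const 2)).abs
    (((lim3.mul hc).sqrt).const_mul (2 / v / 6))
    (eventually_nhdsWithin_of_forall fun t ht => hbound t ht)
  have j1 : Integrable (fun ω => Y ω * f (Y ω)) P :=
    hYint.mul_bdd (hfc.comp_aestronglyMeasurable hYm) (ae_of_all _ fun ω => hf (Y ω))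
  have j2 : Integrable (fun ω => f' (Y ω)) P :=
    (integrable_const (√(2 / π) / √v)).mono' (hf'c.comp_aestronglyMeasurable hYm)
      (ae_of_all _ fun ω => hf' (Y ω))
  have j3 : Integrable (fun ω => f' (Y ω) * S ω) P :=
    hS.bdd_mul (hf'c.comp_aestronglyMeasurable hYm) (ae_of_all _ fun ω => hf' (Y ω))
  have e1 : ∫ ω, f (Y ω) * -(lam * Y ω) ∂P = -(lam * ∫ ω, Y ω * f (Y ω) ∂P) := by
    rw [← integral_const_mul, ← integral_neg]
    exact integral_congr_ae (ae_of_all _ fun ω => by ring)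
  have e2 : ∫ ω, f' (Y ω) * ((2 * lam + S ω) * v) ∂P
      = 2 * lam * v * (∫ ω, f' (Y ω) ∂P) + v * ∫ ω, f' (Y ω) * S ω ∂P := by
    rw [← integral_const_mul, ← integral_const_mul, ← integral_add (j2.const_mul _)
      (j3.const_mul _)]
    exact integral_congr_ae (ae_of_all _ fun ω => by ring)
  have e3 : (∫ ω, h (Y ω) ∂P) - ∫ x, h x ∂(gaussianReal 0 v.toNNReal)
      = v * (∫ ω, f' (Y ω) ∂P) - ∫ ω, Y ω * f (Y ω) ∂P := by
    have e : ∀ x, h x = v * f' x - x * f x + ∫ t, h t ∂(gaussianReal 0 v.toNNReal) := fun x => by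
      rw [hstein]
      ring
    have e' : ∫ ω, h (Y ω) ∂P = ∫ ω, (v * f' (Y ω) - Y ω * f (Y ω)
        + ∫ t, h t ∂(gaussianReal 0 v.toNNReal)) ∂P :=
      integral_congr_ae (ae_of_all _ fun ω => e (Y ω))
    have j4 : Integrable (fun ω => v * f' (Y ω) - Y ω * f (Y ω)) P := (j2.const_mul v).sub j1
    rw [e', integral_add j4 (integrable_const _),
      integral_sub (j2.const_mul v) j1, integral_const_mul]
    simp
  have e4 : ∫ ω, (2 * lam + S ω) * v ∂P = (2 * lam + ∫ ω, S ω ∂P) * v := by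
    rw [integral_mul_const, integral_add (integrable_const _) hS]
    simp
  have e5 : √((2 * lam + ∫ ω, S ω ∂P) * v * (ρ * v ^ 2))
      = √((2 * lam + ∫ ω, S ω ∂P) * v) * √ρ * v := by
    rw [sqrt_mul' _ (by positivity), sqrt_mul hρ, sqrt_sq hσ.le, mul_assoc]
  have hSle : |∫ ω, f' (Y ω) * S ω ∂P| ≤ √(2 / π) / √v * ∫ ω, |S ω| ∂P := by
    rw [← integral_const_mul, ← norm_eq_abs]
    refine norm_integral_le_of_norm_le (hS.abs.const_mul _) (ae_of_all _ fun ω => ?_)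
    rw [norm_mul, norm_eq_abs, norm_eq_abs]
    exact mul_le_mul_of_nonneg_right (hf' _) (abs_nonneg _)
  rw [e1, e2, e4, e5] at hlimit
  rw [e3]
  set A := ∫ ω, f' (Y ω) ∂P
  set B := ∫ ω, Y ω * f (Y ω) ∂P
  set D := ∫ ω, f' (Y ω) * S ω ∂P
  set E := ∫ ω, |S ω| ∂P
  set R := √((2 * lam + ∫ ω, S ω ∂P) * v)
  have hsv : 0 < √v := sqrt_pos.2 hσ
  have hvv : √v * √v = v := mul_self_sqrt hσ.le
  have hpi : √(2 / π) / 2 = 1 / √(2 * π) := by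
    rw [div_eq_div_iff (by norm_num) (by positivity), ← sqrt_mul (by positivity),
      show 2 / π * (2 * π) = 2 ^ 2 by field_simp, sqrt_sq (by norm_num)]
    norm_num
  have hmul : lam * |v * A - B|
      ≤ 2 / v / 6 * (R * √ρ * v) + v / 2 * (√(2 / π) / √v * E) := by
    nth_rewrite 1 [← abs_of_pos hlam]
    rw [← abs_mul, show lam * (v * A - B)
      = (-(lam * B) + (2 * lam * v * A + v * D) / 2) - v / 2 * D by ring]
    refine (abs_sub _ _).trans (add_le_add hlimit ?_)
    rw [abs_mul, abs_of_pos (half_pos hσ)]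
    exact mul_le_mul_of_nonneg_left hSle (half_pos hσ).le
  have hconst : 2 / v / 6 * (R * √ρ * v) + v / 2 * (√(2 / π) / √v * E)
      = lam * (√v / (lam * √(2 * π)) * E + R / (3 * lam) * √ρ) := by
    have h1 : v / 2 * (√(2 / π) / √v * E) = √v * (√(2 / π) / 2) * E := by
      nth_rewrite 1 [← hvv]
      field_simp
    rw [h1, hpi]
    field_simp
    ring
  exact le_of_mul_le_mul_left (hmul.trans hconst.le) hlam
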